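/- Let λ₁∨,…,λ_m∨ be minuscule fundamental coweights with fundamental weights λ₁,…,λ_m, write μ* := −w₀(μ), let σ_j ∈ Σ correspond to λ_j∨, and define π₀ := (Λ₀) and π_j := σ_j^{−1}(π_{j−1} ⋆ (λ_j*)) for j = 1,…,m. Then every π_j is an integral affine-dominant path of weight Λ₀: wt(π_j) = Λ₀ and ⟨π_j(t), α_i∨⟩ ≥ 0 for all t ∈ [0,1] and all i = 0,1,…,r. -/

import Mathlib

/-
Background: reduced irreducible crystallographic root systems with a chosen base,
realized in a real inner product space.  Coweights are represented as vectors of the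
same space via the `W`-invariant inner product (so the coroot of `a` is `2a/(a,a)`).
-/

open scoped RealInnerProductSpace Classical

noncomputable section

namespace Litt

variable {V : Type*} [NormedAddCommGroup V] [InnerProductSpace ℝ V]

/-- The coroot of a root vector, under the inner-product identification of `𝔥` with `𝔥*`. -/
def coroot (a : V) : V := (2 / ⟪a, a⟫) • a

/-- The pairing `⟨x, α∨⟩` of a weight `x` with the coroot of `a`. -/
def pairc (x a : V) : ℝ := ⟪x, coroot a⟫

/-- The reflection `s_a (x) = x - ⟨x, a∨⟩ a`, as a linear map. -/
def sLin (a : V) : V →ₗ[ℝ] V :=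
  LinearMap.id - ((innerₛₗ ℝ (coroot a)).smulRight a)

/-- A reduced irreducible crystallographic root system spanning `V`, together with a
chosen system of simple roots `α 0, …, α (r-1)`. -/
structure RootSystemBase (r : ℕ) (V : Type*) [NormedAddCommGroup V]
    [InnerProductSpace ℝ V] where
  roots : Set V
  α : Fin r → V
  finite : roots.Finite
  ne_zero : ∀ a ∈ roots, a ≠ 0
  span_top : Submodule.span ℝ roots = ⊤
  reduced : ∀ a ∈ roots, ∀ t : ℝ, t • a ∈ roots → t = 1 ∨ t = -1
  reflect_mem : ∀ a ∈ roots, ∀ b ∈ roots, sLin a b ∈ roots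
  cryst : ∀ a ∈ roots, ∀ b ∈ roots, ∃ n : ℤ, pairc b a = (n : ℝ)
  irred : ∀ S T : Set V, roots = S ∪ T → (∀ a ∈ S, ∀ b ∈ T, ⟪a, b⟫ = 0) →
    S = ∅ ∨ T = ∅
  simple_mem : ∀ i, α i ∈ roots
  simple_indep : LinearIndependent ℝ α
  pos_or_neg : ∀ a ∈ roots, (∃ c : Fin r → ℕ, a = ∑ i, (c i : ℝ) • α i) ∨
    (∃ c : Fin r → ℕ, a = -∑ i, (c i : ℝ) • α i)

namespace RootSystemBase

variable {r : ℕ} (R : RootSystemBase r V)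

/-- The positive roots determined by the base. -/
def pos : Set V := {a ∈ R.roots | ∃ c : Fin r → ℕ, a = ∑ i, (c i : ℝ) • R.α i}

/-- `w` is the fundamental weight at node `i`:  `⟨w, α_j∨⟩ = δ_ij`. -/
def IsFundWeight (i : Fin r) (w : V) : Prop :=
  ∀ j, pairc w (R.α j) = if j = i then 1 else 0

/-- `c` is (the image under `ν` of) the fundamental coweight at node `i`:
`⟨α_j, ϖ_i∨⟩ = δ_ij`, the pairing of a root with a coweight being realized by the
inner product. -/
def IsFundCoweight (i : Fin r) (c : V) : Prop :=
  ∀ j, ⟪R.α j, c⟫ = if j = i then 1 else 0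

/-- A coweight is minuscule if it pairs to `0` or `1` with every positive root. -/
def IsMinusculeCoweight (c : V) : Prop :=
  ∀ a ∈ R.pos, ⟪a, c⟫ = 0 ∨ ⟪a, c⟫ = 1

/-- The Weyl group: the subgroup of `GL(V)` generated by the simple reflections. -/
def weyl : Subgroup (V ≃ₗ[ℝ] V) :=
  Subgroup.closure {g | ∃ i : Fin r, ∀ x, g x = sLin (R.α i) x}

/-- The orbit `W·λ` of a weight under the Weyl group. -/
def orbit (lam : V) : Set V := {x | ∃ g ∈ R.weyl, x = g lam}

/-- `w` is the longest element `w₀` of the Weyl group: it sends every positive root to a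
negative root. -/
def IsLongest (w : V ≃ₗ[ℝ] V) : Prop :=
  w ∈ R.weyl ∧ ∀ a ∈ R.pos, -(w a) ∈ R.pos

/-- `w` is the longest element of the parabolic subgroup `Stab_W(ϖ)`: it stabilizes `ϖ`
and sends every positive root pairing to `0` with `ϖ` to a negative root. -/
def IsLongestPar (ϖ : V) (w : V ≃ₗ[ℝ] V) : Prop :=
  w ∈ R.weyl ∧ w ϖ = ϖ ∧ ∀ a ∈ R.pos, pairc ϖ a = 0 → -(w a) ∈ R.pos

/-- `θ` is the highest root: for every root `a`, `θ - a` is a nonnegative combination of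
the simple roots. -/
def IsHighestRoot (θ : V) : Prop :=
  θ ∈ R.pos ∧ ∀ a ∈ R.roots, ∃ c : Fin r → ℕ, θ - a = ∑ i, (c i : ℝ) • R.α i

/-- The coroot lattice, as a `ℤ`-submodule of `V`. -/
def corootLattice : Submodule ℤ V := Submodule.span ℤ (coroot '' R.roots)

end RootSystemBase

end Litt
namespace Litt

/-! ### Littelmann paths as lists of steps

A piecewise-linear path `π = (v₁ ⋆ ⋯ ⋆ v_k)` starting at `0` is recorded by its list of
steps `[v₁, …, v_k]`.  Two step lists describe the same path up to reparametrization
iff they have the same `normalize`d form (zero steps removed, consecutive positively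
proportional steps merged). -/

variable {M : Type*} [AddCommGroup M] [Module ℝ M]

/-- Prepend one step to a normalized list of steps, merging it with the head if the two
are positively proportional and dropping it if it is zero. -/
def consStep (v : M) : List M → List M
  | [] => if v = 0 then [] else [v]
  | w :: L =>
      if v = 0 then w :: L
      else if ∃ c : ℝ, 0 < c ∧ w = c • v then (v + w) :: L else v :: w :: L

/-- The normal form of a step list: two step lists represent the same piecewise-linear
path up to reparametrization iff their normal forms coincide. -/
def normalize : List M → List M := List.foldr consStep []

/-- The concatenation `S₁ ⋆ S₂` of two sets of paths. -/
def starSet (S₁ S₂ : Set (List M)) : Set (List M) := Set.image2 (· ++ ·) S₁ S₂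

/-- The concatenation `S₁ ⋆ ⋯ ⋆ S_m` of a list of sets of paths. -/
def catSets : List (Set (List M)) → Set (List M)
  | [] => {([] : List M)}
  | S :: Ss => starSet S (catSets Ss)

/-- The data of a root operator in the sense of Littelmann: a root vector `vec` (a root
of `𝔤`, or a real root of `𝔤̂` modulo `δ`) together with the linear functional `cov`
given by pairing with its coroot. -/
structure RootOp (M : Type*) [AddCommGroup M] [Module ℝ M] where
  vec : M
  cov : M →ₗ[ℝ] ℝ

namespace RootOp

variable (d : RootOp M)

/-- The associated reflection `s_i x = x - ⟨x, α_i∨⟩ α_i`. -/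
def s (x : M) : M := x - d.cov x • d.vec

/-- The value `h_i` of the height function at the `j`-th corner of the path;
since the height function is affine on each step, its extrema on the path are
attained at corners. -/
def hgt (L : List M) (j : ℕ) : ℝ := d.cov ((L.take j).sum)

/-- The minimum `M` of the height function `h_i` along the path. -/
def minH (L : List M) : ℝ := sInf ((d.hgt L) '' {j | j ≤ L.length})

/-- The corner at which the height function attains its minimum for the last time. -/
def lastMin (L : List M) : ℕ := sSup {j | j ≤ L.length ∧ d.hgt L j = d.minH L}

/-- `f_i` is defined on `π` iff after the last minimum of the height function the height
rises to `M + 1`. -/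
def fDef (L : List M) : Prop :=
  ∃ j ≤ L.length, d.lastMin L < j ∧ d.minH L + 1 ≤ d.hgt L j

/-- The first corner after the last minimum at which the height has reached `M + 1`
(the height first reaches `M + 1` within the step leading to this corner). -/
def fIdx (L : List M) : ℕ :=
  sInf {j | d.lastMin L < j ∧ d.minH L + 1 ≤ d.hgt L j}

/-- The lowering root operator `f_i` on paths (meaningful when `fDef` holds): writing
`π = π₁ ⋆ π₂ ⋆ π₃` where `π₂` is the last subpath on which `M ≤ h_i ≤ M + 1` — it runs
from the last minimum of the height function to the first subsequent point where the
height reaches `M + 1`, splitting the step through which the latter occurs — one sets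
`f_i π := π₁ ⋆ s_i π₂ ⋆ π₃`. -/
def fList (L : List M) : List M :=
  let j1 := d.lastMin L
  let j2 := d.fIdx L
  let v := L.getD (j2 - 1) 0
  let c := (d.minH L + 1 - d.hgt L (j2 - 1)) / (d.hgt L j2 - d.hgt L (j2 - 1))
  L.take j1 ++ ((((L.drop j1).take (j2 - 1 - j1)).map d.s) ++ [d.s (c • v)])
    ++ ([(1 - c) • v] ++ L.drop j2)

/-- The root operator `f_i` as a relation between paths. -/
def frel (L L' : List M) : Prop := d.fDef L ∧ L' = d.fList L

/-- The root operator `f_i` as a relation between paths up to reparametrization. -/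
def frelC (L L' : List M) : Prop :=
  ∃ L₁, normalize L₁ = normalize L ∧ d.fDef L₁ ∧ normalize L' = normalize (d.fList L₁)

end RootOp

/-- The closure of a set of paths under a single root operator `f_i`:
`{f_i^k π ∣ π ∈ S, k ≥ 0}`. -/
def fClos (d : RootOp M) (S : Set (List M)) : Set (List M) :=
  {L' | ∃ L ∈ S, Relation.ReflTransGen d.frel L L'}

/-- The set of paths generated from a set of paths by the root operators `f_i`. -/
def genF {ι : Type*} (D : ι → RootOp M) (S : Set (List M)) : Set (List M) :=
  {L' | ∃ L ∈ S, Relation.ReflTransGen (fun x y => ∃ i, (D i).frel x y) L L'}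

/-- The set of paths generated from a set of paths by the root operators `f_i` and
their inverses `e_i` (recall `e_i π = π' ↔ f_i π' = π`). -/
def genFE {ι : Type*} (D : ι → RootOp M) (S : Set (List M)) : Set (List M) :=
  {L' | ∃ L ∈ S,
    Relation.ReflTransGen (fun x y => ∃ i, (D i).frel x y ∨ (D i).frel y x) L L'}

/-- The Demazure operator `B̂_z` attached to the word `w = [i₁, …, i_m]` (a reduced word
for `z`):  `B̂_z(S) = {f_{i₁}^{k₁} ⋯ f_{i_m}^{k_m} π ∣ π ∈ S, k₁, …, k_m ≥ 0}`. -/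
def demazureWord {ι : Type*} (D : ι → RootOp M) : List ι → Set (List M) → Set (List M)
  | [] => id
  | i :: w => fun S => fClos (D i) (demazureWord D w S)

end Litt
namespace Litt

/-! ### The affine weight space modulo `ℝδ`

The affine weight space `𝔥*_ℝ ⊕ ℝΛ₀` (working modulo `ℝδ` throughout) is realized as
`V × ℝ`, a weight `λ + ℓΛ₀` being the pair `(λ, ℓ)`.  The affine Weyl group and the
translations `t_μ : λ + ℓΛ₀ ↦ λ + ℓμ + ℓΛ₀` act linearly on it. -/

variable {V : Type*} [NormedAddCommGroup V] [InnerProductSpace ℝ V]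

/-- The functional `λ + ℓΛ₀ ↦ ⟨λ, a∨⟩` on the affine weight space. -/
def affCovF (a : V) : (V × ℝ) →ₗ[ℝ] ℝ :=
  (innerₛₗ ℝ (coroot a)).comp (LinearMap.fst ℝ V ℝ)

/-- `Λ₀ = (0, 1)`. -/
def lamZero : V × ℝ := ((0 : V), (1 : ℝ))

/-- The translation `t_μ` acting (mod `ℝδ`) on the affine weight space:
`λ + ℓΛ₀ ↦ λ + ℓμ + ℓΛ₀`. -/
def translLin (μ : V) : (V × ℝ) →ₗ[ℝ] (V × ℝ) :=
  (LinearMap.fst ℝ V ℝ + (LinearMap.snd ℝ V ℝ).smulRight μ).prod (LinearMap.snd ℝ V ℝ)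

/-- The extension of a linear map on `V` to the affine weight space, fixing `Λ₀`. -/
def affExt (g : V →ₗ[ℝ] V) : (V × ℝ) →ₗ[ℝ] (V × ℝ) :=
  (g.comp (LinearMap.fst ℝ V ℝ)).prod (LinearMap.snd ℝ V ℝ)

/-- The pointwise action of a (piecewise-linearity preserving) transformation of the
affine weight space on a path, recorded on step lists via the corner points. -/
def mapSteps (g : (V × ℝ) → (V × ℝ)) (L : List (V × ℝ)) : List (V × ℝ) :=
  (List.range L.length).map fun j => g ((L.take (j + 1)).sum) - g ((L.take j).sum)

namespace RootSystemBase

variable {r : ℕ} (R : RootSystemBase r V)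

/-- The affine root operators (for `𝔤̂`, mod `ℝδ`): index `0` is the affine node, with
root `α₀ = δ - θ ≡ -θ` and pairing `⟨λ + ℓΛ₀, α₀∨⟩ = ℓ - ⟨λ, θ∨⟩`; index `i.succ` is
the finite node `i`, with root `α_i` and pairing `⟨λ + ℓΛ₀, α_i∨⟩ = ⟨λ, α_i∨⟩`. -/
def affOp (θ : V) : Fin (r + 1) → RootOp (V × ℝ) :=
  Fin.cases ⟨((-θ : V), (0 : ℝ)), LinearMap.snd ℝ V ℝ - affCovF θ⟩
    (fun i => ⟨((R.α i : V), (0 : ℝ)), affCovF (R.α i)⟩)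

/-- A path in the affine weight space is dominant if it stays in the fundamental
chamber: `⟨π(t), α_i∨⟩ ≥ 0` for all `t ∈ [0,1]` and all `i = 0, …, r`  (the heights
being affine on each step, this holds iff it holds at every corner). -/
def AffDominant (θ : V) (L : List (V × ℝ)) : Prop :=
  ∀ j ≤ L.length, ∀ i : Fin (r + 1), 0 ≤ (R.affOp θ i).hgt L j

/-- A path is integral if all its steps are integral weights. -/
def AffIntegral (θ : V) (L : List (V × ℝ)) : Prop :=
  ∀ v ∈ L, ∀ i : Fin (r + 1), ∃ n : ℤ, (R.affOp θ i).cov v = (n : ℝ)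

/-- The Littelmann crystal `B(μ)` generated from the straight-line path `(μ)` by the
root operators `f_1, …, f_r` of the finite algebra `𝔤`, embedded in the affine weight
space at level `0`. -/
def finCrystal (μ : V) : Set (List (V × ℝ)) :=
  genF (fun i : Fin r => RootOp.mk ((R.α i : V), (0 : ℝ)) (affCovF (R.α i)))
    {[((μ : V), (0 : ℝ))]}

/-- The product `s_{i₁} ⋯ s_{i_m}` of the affine simple reflections along a word. -/
def wordProd (θ : V) (w : List (Fin (r + 1))) : (V × ℝ) → (V × ℝ) :=
  (w.map fun i => (R.affOp θ i).s).foldr (· ∘ ·) id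

/-- `w` is a reduced word for the transformation `z` of the affine weight space:
its product is `z` and no shorter word of affine simple reflections has product `z`. -/
def IsReducedWord (θ : V) (z : (V × ℝ) → (V × ℝ)) (w : List (Fin (r + 1))) : Prop :=
  R.wordProd θ w = z ∧ ∀ w', R.wordProd θ w' = z → w.length ≤ w'.length

end RootSystemBase

end Litt
namespace Litt

variable {V : Type*} [NormedAddCommGroup V] [InnerProductSpace ℝ V]

/-- The sequence of dominant paths `π₀ := (Λ₀)`, `π_j := σ_j⁻¹ (π_{j-1} ⋆ (λ_j*))`,
given the inverses `σinv (j-1) = σ_j⁻¹` of the chamber automorphisms (acting linearly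
on the affine weight space mod `ℝδ`) and the steps `st (j-1) = (λ_j*, 0)`. -/
def piSeq (σinv : ℕ → ((V × ℝ) →ₗ[ℝ] (V × ℝ))) (st : ℕ → V × ℝ) : ℕ → List (V × ℝ)
  | 0 => [((0 : V), (1 : ℝ))]
  | j + 1 => (piSeq σinv st j ++ [st j]).map (σinv j)

end Litt
namespace Litt

section RootSystem

variable {V : Type*} [NormedAddCommGroup V] [InnerProductSpace ℝ V]

lemma pairc_eq (x a : V) : pairc x a = 2 / ⟪a, a⟫ * ⟪x, a⟫ := by
  simp [pairc, coroot, inner_smul_right]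

lemma affCovF_apply (a : V) (v : V × ℝ) : affCovF a v = pairc v.1 a := by
  simp [affCovF, pairc, real_inner_comm]

lemma sLin_apply (a x : V) : sLin a x = x - pairc x a • a := by
  simp [sLin, pairc, real_inner_comm]

lemma inner_self_pos {a : V} (ha : a ≠ 0) : 0 < ⟪a, a⟫ :=
  real_inner_self_pos.mpr ha

lemma inner_sLin_sLin {a : V} (ha : a ≠ 0) (x y : V) : ⟪sLin a x, sLin a y⟫ = ⟪x, y⟫ := by
  have h := (inner_self_pos ha).ne'
  simp only [sLin_apply, pairc_eq, inner_sub_left, inner_sub_right, real_inner_smul_left,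
    real_inner_smul_right]
  rw [real_inner_comm a y]
  field_simp
  ring

lemma sLin_sLin {a : V} (ha : a ≠ 0) (x : V) : sLin a (sLin a x) = x := by
  have h := (inner_self_pos ha).ne'
  simp only [sLin_apply, pairc_eq, inner_sub_left, real_inner_smul_left]
  rw [sub_sub, ← add_smul, sub_eq_self]
  convert zero_smul ℝ a using 2
  field_simp
  ring

lemma pairc_sub (x y a : V) : pairc (x - y) a = pairc x a - pairc y a := by
  simp [pairc, inner_sub_left]

lemma pairc_add (x y a : V) : pairc (x + y) a = pairc x a + pairc y a := by
  simp [pairc, inner_add_left]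

lemma pairc_smul (t : ℝ) (x a : V) : pairc (t • x) a = t * pairc x a := by
  simp [pairc, real_inner_smul_left]

namespace RootSystemBase

variable {r : ℕ} (R : RootSystemBase r V)

lemma simple_ne_zero (i : Fin r) : R.α i ≠ 0 := R.ne_zero _ (R.simple_mem i)

/-- A property stable under the simple reflections is stable under the Weyl group. -/
lemma weyl_stable (S : V → Prop) (h : ∀ i x, S x → S (sLin (R.α i) x))
    {g : V ≃ₗ[ℝ] V} (hg : g ∈ R.weyl) {x : V} (hx : S x) : S (g x) := by
  have key : (∀ x, S x → S (g x)) ∧ ∀ x, S x → S (g⁻¹ x) := by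
    refine Subgroup.closure_induction
      (p := fun g _ => (∀ x, S x → S (g x)) ∧ ∀ x, S x → S (g⁻¹ x)) ?_ ?_ ?_ ?_ hg
    · rintro g ⟨i, hi⟩
      refine ⟨fun x hx => hi x ▸ h i x hx, fun x hx => ?_⟩
      have : g⁻¹ x = sLin (R.α i) x := by
        apply g.injective
        rw [hi (sLin _ x), sLin_sLin (R.simple_ne_zero i)]
        exact g.apply_symm_apply x
      rw [this]
      exact h i x hx
    · exact ⟨fun x hx => hx, fun x hx => hx⟩
    · rintro g k - - ⟨h1, h2⟩ ⟨h3, h4⟩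
      refine ⟨fun x hx => h1 _ (h3 _ hx), fun x hx => ?_⟩
      rw [mul_inv_rev]
      exact h4 _ (h2 _ hx)
    · rintro g - ⟨h1, h2⟩
      exact ⟨h2, by simpa using h1⟩
  exact key.1 x hx

lemma weyl_inner {g : V ≃ₗ[ℝ] V} (hg : g ∈ R.weyl) (x y : V) : ⟪g x, g y⟫ = ⟪x, y⟫ := by
  have key : ∀ x y, ⟪g x, g y⟫ = ⟪x, y⟫ := by
    refine Subgroup.closure_induction (p := fun g _ => ∀ x y, ⟪g x, g y⟫ = ⟪x, y⟫)
      ?_ ?_ ?_ ?_ hg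
    · rintro g ⟨i, hi⟩ x y
      rw [hi, hi, inner_sLin_sLin (R.simple_ne_zero i)]
    · exact fun x y => rfl
    · intro g k _ _ h1 h2 x y
      exact (h1 _ _).trans (h2 _ _)
    · intro g _ h x y
      rw [← h]
      exact congrArg₂ _ (g.apply_symm_apply x) (g.apply_symm_apply y)
  exact key x y

lemma weyl_inv_inner {g : V ≃ₗ[ℝ] V} (hg : g ∈ R.weyl) (x y : V) :
    ⟪g⁻¹ x, y⟫ = ⟪x, g y⟫ := by
  rw [← R.weyl_inner hg]
  exact congrArg₂ _ (g.apply_symm_apply x) rfl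

lemma pairc_weyl_inv {g : V ≃ₗ[ℝ] V} (hg : g ∈ R.weyl) (x a : V) :
    pairc (g⁻¹ x) a = pairc x (g a) := by
  rw [pairc_eq, pairc_eq, R.weyl_inner hg, R.weyl_inv_inner hg]

lemma weyl_mem_roots {g : V ≃ₗ[ℝ] V} (hg : g ∈ R.weyl) {a : V} (ha : a ∈ R.roots) :
    g a ∈ R.roots :=
  R.weyl_stable (· ∈ R.roots) (fun i x hx => R.reflect_mem _ (R.simple_mem i) x hx) hg ha

/-- A vector is an integral weight if it pairs integrally with all simple coroots. -/
def IsWeight (x : V) : Prop := ∀ i, ∃ n : ℤ, pairc x (R.α i) = n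

variable {R}

lemma IsWeight.sub {x y : V} (hx : R.IsWeight x) (hy : R.IsWeight y) : R.IsWeight (x - y) := by
  intro i
  obtain ⟨p, hp⟩ := hx i
  obtain ⟨q, hq⟩ := hy i
  exact ⟨p - q, by rw [pairc_sub, hp, hq]; push_cast; rfl⟩

lemma IsWeight.add {x y : V} (hx : R.IsWeight x) (hy : R.IsWeight y) : R.IsWeight (x + y) := by
  intro i
  obtain ⟨p, hp⟩ := hx i
  obtain ⟨q, hq⟩ := hy i
  exact ⟨p + q, by rw [pairc_add, hp, hq]; push_cast; rfl⟩

lemma IsWeight.int_smul {x : V} (hx : R.IsWeight x) (n : ℤ) : R.IsWeight ((n : ℝ) • x) := by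
  intro i
  obtain ⟨p, hp⟩ := hx i
  exact ⟨n * p, by rw [pairc_smul, hp]; push_cast; rfl⟩

lemma IsFundWeight.isWeight {i : Fin r} {w : V} (hw : R.IsFundWeight i w) : R.IsWeight w := by
  intro j
  rw [hw j]
  split_ifs
  exacts [⟨1, by simp⟩, ⟨0, by simp⟩]

lemma IsWeight.reflect {x : V} (hx : R.IsWeight x) (i : Fin r) : R.IsWeight (sLin (R.α i) x) := by
  obtain ⟨n, hn⟩ := hx i
  rw [sLin_apply, hn]
  exact hx.sub (IsWeight.int_smul (fun j => R.cryst _ (R.simple_mem j) _ (R.simple_mem i)) n)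

lemma IsWeight.weyl {x : V} (hx : R.IsWeight x) {g : V ≃ₗ[ℝ] V} (hg : g ∈ R.weyl) :
    R.IsWeight (g x) :=
  R.weyl_stable R.IsWeight (fun i _ h => h.reflect i) hg hx

variable (R)

lemma coeff_unique {f g : Fin r → ℝ} (h : ∑ i, f i • R.α i = ∑ i, g i • R.α i) : f = g := by
  have := Fintype.linearIndependent_iff.mp R.simple_indep (f - g)
    (by simp [sub_smul, Finset.sum_sub_distrib, h])
  funext i
  simpa [sub_eq_zero] using this i

/-- A root with some positive simple coefficient is a positive root. -/
lemma nat_coeff_of_pos_coeff {a : V} (ha : a ∈ R.roots) {f : Fin r → ℝ}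
    (hf : a = ∑ i, f i • R.α i) {i : Fin r} (hi : 0 < f i) :
    ∃ c : Fin r → ℕ, (∀ j, f j = c j) ∧ a = ∑ j, (c j : ℝ) • R.α j := by
  rcases R.pos_or_neg a ha with ⟨c, hc⟩ | ⟨c, hc⟩
  · exact ⟨c, congrFun (R.coeff_unique (g := fun j => (c j : ℝ)) (hf.symm.trans hc)), hc⟩
  · have h : f i = -(c i : ℝ) := congrFun (R.coeff_unique (f := f)
      (g := fun j => -(c j : ℝ)) (by rw [← hf, hc]; simp)) i
    have : (0 : ℝ) ≤ c i := Nat.cast_nonneg _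
    linarith

lemma inner_nonneg_of_pos {x a : V} (ha : a ∈ R.pos) (hx : ∀ k, 0 ≤ ⟪x, R.α k⟫) :
    0 ≤ ⟪x, a⟫ := by
  obtain ⟨-, c, rfl⟩ := ha
  rw [inner_sum]
  refine Finset.sum_nonneg fun k _ => ?_
  rw [real_inner_smul_right]
  exact mul_nonneg (Nat.cast_nonneg _) (hx k)

lemma sub_single_expansion (f : Fin r → ℝ) (t : ℝ) (k : Fin r) :
    ∑ j, f j • R.α j - t • R.α k = ∑ j, (f j - if j = k then t else 0) • R.α j := by
  simp [sub_smul, Finset.sum_sub_distrib, ite_smul]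

lemma inner_simple_nonpos {i k : Fin r} (h : i ≠ k) : ⟪R.α i, R.α k⟫ ≤ 0 := by
  have hroot := R.reflect_mem _ (R.simple_mem k) _ (R.simple_mem i)
  have hexp : sLin (R.α k) (R.α i) = ∑ j, ((if j = i then 1 else 0) -
      if j = k then pairc (R.α i) (R.α k) else 0) • R.α j := by
    rw [← R.sub_single_expansion, sLin_apply]
    simp
  obtain ⟨c, hc, -⟩ := R.nat_coeff_of_pos_coeff hroot hexp (i := i) (by simp [h])
  have hk := hc k
  simp only [h.symm, if_false, if_true, pairc_eq] at hk
  have h1 : (0 : ℝ) ≤ c k := Nat.cast_nonneg _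
  by_contra! hlt
  have := mul_pos (div_pos two_pos (inner_self_pos (R.simple_ne_zero k))) hlt
  linarith

/-- Every coroot pairs integrally with every integral weight. -/
lemma IsWeight.pairc_pos_int (n : ℕ) :
    ∀ (c : Fin r → ℕ) (b : V), b ∈ R.roots → b = ∑ i, (c i : ℝ) • R.α i → ∑ i, c i = n →
    ∀ x, R.IsWeight x → ∃ p : ℤ, pairc x b = p := by
  induction n using Nat.strong_induction_on with
  | _ n ih =>
  intro c b hb hc hn x hx
  have hbb := inner_self_pos (R.ne_zero b hb)
  obtain ⟨k, hck, hk⟩ : ∃ k, 0 < c k ∧ 0 < ⟪b, R.α k⟫ := by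
    by_contra! hcon
    have : ⟪b, b⟫ ≤ 0 := by
      have hsum : ⟪b, b⟫ = ∑ k, ⟪b, (c k : ℝ) • R.α k⟫ := by rw [← inner_sum, ← hc]
      rw [hsum]
      refine Finset.sum_nonpos fun k _ => ?_
      rw [real_inner_smul_right]
      rcases Nat.eq_zero_or_pos (c k) with h | h
      · simp [h]
      · exact mul_nonpos_of_nonneg_of_nonpos (Nat.cast_nonneg _) (hcon k h)
    linarith
  by_cases hj : ∃ j, j ≠ k ∧ 0 < c j
  · obtain ⟨j, hjk, hcj⟩ := hj
    have hroot := R.reflect_mem _ (R.simple_mem k) _ hb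
    have hexp : sLin (R.α k) b =
        ∑ j, ((c j : ℝ) - if j = k then pairc b (R.α k) else 0) • R.α j := by
      rw [← R.sub_single_expansion, sLin_apply, ← hc]
    obtain ⟨c', hc', hb'⟩ := R.nat_coeff_of_pos_coeff hroot hexp (i := j)
      (by simpa [hjk] using hcj)
    have hp : 0 < pairc b (R.α k) := by
      rw [pairc_eq]
      exact mul_pos (div_pos two_pos (inner_self_pos (R.simple_ne_zero k))) hk
    have hlt : ∑ i, c' i < n := by
      have : ((∑ i, c' i : ℕ) : ℝ) = (n : ℝ) - pairc b (R.α k) := by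
        push_cast
        rw [← Finset.sum_congr rfl fun i _ => hc' i, Finset.sum_sub_distrib, ← hn]
        simp
      exact_mod_cast (by linarith : ((∑ i, c' i : ℕ) : ℝ) < n)
    obtain ⟨p, hp⟩ := ih _ hlt c' _ hroot hb' rfl _ (hx.reflect k)
    refine ⟨p, ?_⟩
    rw [← hp, pairc_eq, pairc_eq, inner_sLin_sLin (R.simple_ne_zero k),
      inner_sLin_sLin (R.simple_ne_zero k)]
  · push Not at hj
    have hbk : b = (c k : ℝ) • R.α k := by
      rw [hc]
      refine Finset.sum_eq_single k (fun j _ h => ?_) (by simp)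
      simp [Nat.le_zero.mp (hj j h)]
    rcases R.reduced _ (R.simple_mem k) (c k) (hbk ▸ hb) with h | h
    · rw [hbk, h, one_smul]
      exact hx k
    · have : (0 : ℝ) ≤ c k := Nat.cast_nonneg _
      linarith

variable {R}

lemma IsWeight.pairc_int {x b : V} (hx : R.IsWeight x) (hb : b ∈ R.pos) :
    ∃ p : ℤ, pairc x b = p := by
  obtain ⟨hb, c, hc⟩ := hb
  exact IsWeight.pairc_pos_int R _ c b hb hc rfl x hx

lemma IsFundCoweight.inner_sum_eq {i : Fin r} {cw : V} (hcw : R.IsFundCoweight i cw)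
    (f : Fin r → ℝ) : ⟪∑ j, f j • R.α j, cw⟫ = f i := by
  simp only [sum_inner, real_inner_smul_left, hcw _]
  simp

lemma IsFundWeight.inner_simple {i : Fin r} {w : V} (hw : R.IsFundWeight i w) (k : Fin r) :
    ⟪w, R.α k⟫ = if k = i then ⟪R.α i, R.α i⟫ / 2 else 0 := by
  have h := hw k
  have hk := (inner_self_pos (R.simple_ne_zero k)).ne'
  rw [pairc_eq] at h
  split_ifs at h ⊢ with hki
  · subst hki
    field_simp at h
    linarith
  · simpa [R.simple_ne_zero k] using h

/-- On roots, the fundamental weight and the fundamental coweight at the same node are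
proportional functionals. -/
lemma IsFundWeight.inner_root {i : Fin r} {w cw : V} (hw : R.IsFundWeight i w)
    (hcw : R.IsFundCoweight i cw) {a : V} (ha : a ∈ R.roots) :
    ⟪w, a⟫ = ⟪a, cw⟫ * (⟪R.α i, R.α i⟫ / 2) := by
  have key : ∀ f : Fin r → ℝ, ⟪w, ∑ j, f j • R.α j⟫ = f i * (⟪R.α i, R.α i⟫ / 2) := by
    intro f
    simp only [inner_sum, real_inner_smul_right, hw.inner_simple]
    simp
  rcases R.pos_or_neg a ha with ⟨f, hf⟩ | ⟨f, hf⟩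
  · rw [hf, key, hcw.inner_sum_eq fun j => (f j : ℝ)]
  · rw [hf, inner_neg_right, inner_neg_left, key, hcw.inner_sum_eq fun j => (f j : ℝ), neg_mul]

lemma IsFundWeight.inner_pos_nonneg {i : Fin r} {w : V} (hw : R.IsFundWeight i w) {a : V}
    (ha : a ∈ R.pos) : 0 ≤ ⟪w, a⟫ := by
  refine R.inner_nonneg_of_pos ha fun k => ?_
  rw [hw.inner_simple]
  have := inner_self_pos (R.simple_ne_zero i)
  split_ifs
  exacts [by positivity, le_rfl]

variable (R) in
lemma pos_or_neg_mem {a : V} (ha : a ∈ R.roots) : a ∈ R.pos ∨ -a ∈ R.pos := by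
  have hneg : -a ∈ R.roots := by
    have h := R.reflect_mem a ha a ha
    rwa [sLin_apply, pairc_eq, div_mul_cancel₀ _ (inner_self_pos (R.ne_zero a ha)).ne',
      two_smul, sub_add_cancel_left] at h
  rcases R.pos_or_neg a ha with h | ⟨c, hc⟩
  · exact Or.inl ⟨ha, h⟩
  · exact Or.inr ⟨hneg, c, by rw [hc, neg_neg]⟩

lemma IsFundWeight.mem_pos {i : Fin r} {w : V} (hw : R.IsFundWeight i w) {a : V}
    (ha : a ∈ R.roots) (hwa : 0 < ⟪w, a⟫) : a ∈ R.pos := by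
  refine (R.pos_or_neg_mem ha).resolve_right fun h => ?_
  have := hw.inner_pos_nonneg h
  rw [inner_neg_right] at this
  linarith

lemma IsHighestRoot.inner_simple_nonneg {θ : V} (hθ : R.IsHighestRoot θ) (k : Fin r) :
    0 ≤ ⟪θ, R.α k⟫ := by
  obtain ⟨c, hc⟩ := hθ.2 _ (R.reflect_mem _ (R.simple_mem k) _ hθ.1.1)
  rw [sLin_apply, sub_sub_cancel] at hc
  have h := congrFun (R.coeff_unique (f := fun j => if j = k then pairc θ (R.α k) else 0)
    (g := fun j => (c j : ℝ)) (by rw [← hc]; simp [ite_smul])) k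
  simp only [if_true, pairc_eq] at h
  have h1 : (0 : ℝ) ≤ c k := Nat.cast_nonneg _
  by_contra! hlt
  have := mul_neg_of_pos_of_neg
    (div_pos two_pos (inner_self_pos (R.simple_ne_zero k))) hlt
  linarith

lemma IsMinusculeCoweight.inner_highestRoot {θ : V} (hθ : R.IsHighestRoot θ) {i : Fin r}
    {cw : V} (hcw : R.IsFundCoweight i cw) (hmin : R.IsMinusculeCoweight cw) :
    ⟪θ, cw⟫ = 1 := by
  obtain ⟨d, hd⟩ := hθ.2 _ (R.simple_mem i)
  have h := hcw.inner_sum_eq fun j => (d j : ℝ)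
  rw [← hd, inner_sub_left, hcw i, if_pos rfl] at h
  have hd0 : (0 : ℝ) ≤ d i := Nat.cast_nonneg _
  rcases hmin θ hθ.1 with h0 | h0 <;> linarith

/-- The simple root dual to a minuscule coweight has the length of the highest root. -/
lemma IsMinusculeCoweight.norm_eq {θ : V} (hθ : R.IsHighestRoot θ) {i : Fin r} {cw w : V}
    {g : V ≃ₗ[ℝ] V} (hcw : R.IsFundCoweight i cw) (hmin : R.IsMinusculeCoweight cw)
    (hw : R.IsFundWeight i w) (hg : R.IsLongestPar w g) :
    ⟪R.α i, R.α i⟫ = ⟪θ, θ⟫ := by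
  have hθc := hmin.inner_highestRoot hθ hcw
  have hi := inner_self_pos (R.simple_ne_zero i)
  have hθpos := inner_self_pos (R.ne_zero θ hθ.1.1)
  apply le_antisymm
  · have hβ : g⁻¹ (R.α i) ∈ R.roots := R.weyl_mem_roots (inv_mem hg.1) (R.simple_mem i)
    have hββ : ⟪g⁻¹ (R.α i), g⁻¹ (R.α i)⟫ = ⟪R.α i, R.α i⟫ := R.weyl_inner (inv_mem hg.1) _ _
    have hβc : ⟪g⁻¹ (R.α i), cw⟫ = 1 := by
      have h := hw.inner_root hcw hβ
      rw [real_inner_comm, R.weyl_inv_inner hg.1, hg.2.1, real_inner_comm, hw.inner_simple,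
        if_pos rfl] at h
      have h2 : ⟪R.α i, R.α i⟫ / 2 ≠ 0 := by positivity
      exact mul_right_cancel₀ h2 (by rw [one_mul, ← h])
    have hβk : ∀ k, k ≠ i → 0 ≤ ⟪g⁻¹ (R.α i), R.α k⟫ := by
      intro k hk
      rw [R.weyl_inv_inner hg.1]
      have hpk : R.α k ∈ R.pos := ⟨R.simple_mem k, fun j => if j = k then 1 else 0, by simp⟩
      have hneg := hg.2.2 _ hpk (by rw [hw k, if_neg hk])
      have hroot := hneg.1
      have hcoef : ⟪-(g (R.α k)), cw⟫ = 0 := by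
        have h := hw.inner_root hcw hroot
        have h3 : ⟪w, g (R.α k)⟫ = 0 := by
          rw [← R.weyl_inv_inner hg.1, show g⁻¹ w = w from
            (g.symm_apply_eq).mpr hg.2.1.symm, hw.inner_simple, if_neg hk]
        rw [inner_neg_right, h3, neg_zero] at h
        have h2 : ⟪R.α i, R.α i⟫ / 2 ≠ 0 := by positivity
        exact (mul_eq_zero.mp h.symm).resolve_right h2
      obtain ⟨d, hd⟩ := hneg.2
      rw [hd, hcw.inner_sum_eq fun j => (d j : ℝ)] at hcoef
      have : ⟪R.α i, -(g (R.α k))⟫ ≤ 0 := by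
        rw [hd, inner_sum]
        refine Finset.sum_nonpos fun j _ => ?_
        rw [real_inner_smul_right]
        by_cases hj : j = i
        · subst hj
          simp [hcoef]
        · exact mul_nonpos_of_nonneg_of_nonpos (Nat.cast_nonneg _)
            (R.inner_simple_nonpos (Ne.symm hj))
      rw [inner_neg_right] at this
      linarith
    obtain ⟨d, hd⟩ := hθ.2 _ hβ
    have hdi : (d i : ℝ) = 0 := by
      have h := hcw.inner_sum_eq fun j => (d j : ℝ)
      rw [← hd, inner_sub_left, hθc, hβc, sub_self] at h
      exact h.symm
    have h1 : 0 ≤ ⟪θ, θ - g⁻¹ (R.α i)⟫ := by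
      rw [hd, inner_sum]
      refine Finset.sum_nonneg fun j _ => ?_
      rw [real_inner_smul_right]
      exact mul_nonneg (Nat.cast_nonneg _) (hθ.inner_simple_nonneg j)
    have h2 : 0 ≤ ⟪g⁻¹ (R.α i), θ - g⁻¹ (R.α i)⟫ := by
      rw [hd, inner_sum]
      refine Finset.sum_nonneg fun j _ => ?_
      rw [real_inner_smul_right]
      by_cases hj : j = i
      · subst hj
        simp [hdi]
      · exact mul_nonneg (Nat.cast_nonneg _) (hβk j hj)
    rw [inner_sub_right] at h1 h2
    linarith [real_inner_comm θ (g⁻¹ (R.α i))]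
  · obtain ⟨p, hp⟩ := hw.isWeight.pairc_int hθ.1
    rw [pairc_eq, hw.inner_root hcw hθ.1.1, hθc] at hp
    have hp' : ⟪R.α i, R.α i⟫ = p * ⟪θ, θ⟫ := by
      rw [← hp]
      field_simp
    have hp0 : (0 : ℝ) < p := by
      rw [← hp]
      positivity
    have hp1 : (1 : ℝ) ≤ p := by
      exact_mod_cast Int.add_one_le_of_lt (by exact_mod_cast hp0 : (0 : ℤ) < p)
    rw [hp']
    exact le_mul_of_one_le_left hθpos.le hp1

/-! ### The affine fundamental chamber -/

/-- The affine weight `v` lies in the closed fundamental affine chamber. -/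
def InChamber (R : RootSystemBase r V) (θ : V) (v : V × ℝ) : Prop :=
  (∀ k, 0 ≤ ⟪v.1, R.α k⟫) ∧ pairc v.1 θ ≤ v.2

lemma inChamber_iff {θ : V} {v : V × ℝ} :
    (∀ i, 0 ≤ (R.affOp θ i).cov v) ↔ R.InChamber θ v := by
  rw [Fin.forall_fin_succ, and_comm]
  refine and_congr (forall_congr' fun k => ?_) ?_
  · simp only [affOp, Fin.cases_succ, affCovF_apply, pairc_eq]
    exact mul_nonneg_iff_of_pos_left (div_pos two_pos (inner_self_pos (R.simple_ne_zero k)))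
  · simp [affOp, affCovF_apply]

lemma affIntegral_iff {θ : V} (hθ : R.IsHighestRoot θ) {v : V × ℝ} :
    (∀ i, ∃ n : ℤ, (R.affOp θ i).cov v = n) ↔ R.IsWeight v.1 ∧ ∃ n : ℤ, v.2 = n := by
  rw [Fin.forall_fin_succ, and_comm]
  have hw : (∀ i : Fin r, ∃ n : ℤ, (R.affOp θ i.succ).cov v = n) ↔ R.IsWeight v.1 := by
    simp [affOp, affCovF_apply, IsWeight]
  rw [hw]
  refine and_congr_right fun h => ?_
  obtain ⟨p, hp⟩ := h.pairc_int hθ.1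
  simp only [affOp, Fin.cases_zero, LinearMap.sub_apply, LinearMap.snd_apply, affCovF_apply, hp]
  constructor
  · rintro ⟨n, hn⟩
    exact ⟨n + p, by push_cast; linarith⟩
  · rintro ⟨n, hn⟩
    exact ⟨n - p, by push_cast; linarith⟩

/-- The inverse `t_ϖ (w₀ w_i)⁻¹` of the chamber automorphism attached to a minuscule coweight
preserves the fundamental affine chamber. -/
lemma InChamber.chamberAut {θ : V} (hθ : R.IsHighestRoot θ) {w₀ g : V ≃ₗ[ℝ] V}
    (hw₀ : R.IsLongest w₀) {i : Fin r} {cw w : V} (hcw : R.IsFundCoweight i cw)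
    (hmin : R.IsMinusculeCoweight cw) (hw : R.IsFundWeight i w) (hg : R.IsLongestPar w g)
    {v : V × ℝ} (hv : R.InChamber θ v) :
    R.InChamber θ ((w₀ * g)⁻¹ v.1 + v.2 • w, v.2) := by
  have hu : w₀ * g ∈ R.weyl := mul_mem hw₀.1 hg.1
  have hlen := hmin.norm_eq hθ hcw hw hg
  have hi := inner_self_pos (R.simple_ne_zero i)
  have hθpos := inner_self_pos (R.ne_zero θ hθ.1.1)
  have hginv : ∀ a, ⟪w, g a⟫ = ⟪w, a⟫ := fun a => by
    rw [← R.weyl_inv_inner hg.1, show g⁻¹ w = w from (g.symm_apply_eq).mpr hg.2.1.symm]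
  -- roots pairing positively with the fundamental weight are sent to negative roots
  have hneg : ∀ a ∈ R.roots, 0 < ⟪w, a⟫ → -((w₀ * g) a) ∈ R.pos := fun a ha hwa =>
    hw₀.2 _ (hw.mem_pos (R.weyl_mem_roots hg.1 ha) (hwa.trans_eq (hginv a).symm))
  refine ⟨fun k => ?_, ?_⟩
  · simp only [inner_add_left, R.weyl_inv_inner hu, real_inner_smul_left, hw.inner_simple]
    by_cases hk : k = i
    · subst hk
      rw [if_pos rfl]
      have hβ := hneg _ (R.simple_mem k) (by rw [hw.inner_simple, if_pos rfl]; positivity)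
      obtain ⟨d, hd⟩ := hθ.2 _ hβ.1
      have h1 : 0 ≤ ⟪v.1, θ - -((w₀ * g) (R.α k))⟫ := by
        rw [hd, inner_sum]
        refine Finset.sum_nonneg fun j _ => ?_
        rw [real_inner_smul_right]
        exact mul_nonneg (Nat.cast_nonneg _) (hv.1 j)
      have h2 := hv.2
      rw [pairc_eq, div_mul_eq_mul_div, div_le_iff₀ hθpos] at h2
      rw [sub_neg_eq_add, inner_add_right] at h1
      rw [hlen]
      linarith
    · rw [if_neg hk, mul_zero, add_zero]
      have hpk : R.α k ∈ R.pos := ⟨R.simple_mem k, fun j => if j = k then 1 else 0, by simp⟩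
      have h := hw₀.2 _ (hg.2.2 _ hpk (by rw [hw k, if_neg hk]))
      rw [map_neg, neg_neg] at h
      exact R.inner_nonneg_of_pos h hv.1
  · have hwθ : ⟪w, θ⟫ = ⟪θ, θ⟫ / 2 := by
      rw [hw.inner_root hcw hθ.1.1, hmin.inner_highestRoot hθ hcw, one_mul, hlen]
    have hβ := hneg _ hθ.1.1 (by rw [hwθ]; positivity)
    have h := R.inner_nonneg_of_pos hβ hv.1
    rw [inner_neg_right] at h
    simp only [pairc_eq, inner_add_left, R.weyl_inv_inner hu, real_inner_smul_left, hwθ]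
    rw [div_mul_eq_mul_div, div_le_iff₀ hθpos]
    linarith

lemma inChamber_lamZero {θ : V} : R.InChamber θ lamZero := by
  simp [InChamber, lamZero, pairc_eq]

end RootSystemBase

end RootSystem

/-- **The winding paths `π_j` are integral dominant of weight `Λ₀`** (Magyar, proof of
Theorem 3, Sec. 2.5).  Let `λ₁∨, …, λ_m∨` be minuscule fundamental coweights with
fundamental weights `λ₁, …, λ_m`, let `σ_j = σ̄_j t_{-λ_j} ∈ Σ` (with
`σ̄_j = w₀ w_{i_j}`) be the chamber automorphism attached to `λ_j∨`, and define
`π₀ := (Λ₀)`, `π_j := σ_j⁻¹ (π_{j-1} ⋆ (λ_j*))` where `λ_j* = -w₀ λ_j`.  Then every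
`π_j` (`j = 0, 1, …, m`) is an integral affine-dominant path of weight `Λ₀`. -/
theorem piSeq_integral_dominant
    {V : Type*} [NormedAddCommGroup V] [InnerProductSpace ℝ V] {r : ℕ}
    (R : RootSystemBase r V)
    (θ : V) (hθ : R.IsHighestRoot θ)
    (w₀ : V ≃ₗ[ℝ] V) (hw₀ : R.IsLongest w₀)
    (m : ℕ) (idx : ℕ → Fin r) (c lam : ℕ → V) (wpar : ℕ → (V ≃ₗ[ℝ] V))
    (hc : ∀ j < m, R.IsFundCoweight (idx j) (c j))
    (hmin : ∀ j < m, R.IsMinusculeCoweight (c j))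
    (hlam : ∀ j < m, R.IsFundWeight (idx j) (lam j))
    (hwpar : ∀ j < m, R.IsLongestPar (lam j) (wpar j)) :
    -- `σinv j` is the inverse `σ_{j+1}⁻¹ = t_{λ_{j+1}} σ̄_{j+1}⁻¹` of the chamber
    -- automorphism `σ_{j+1} = σ̄_{j+1} t_{-λ_{j+1}}`, acting linearly on the affine
    -- weight space mod `ℝδ`; `st j = (λ_{j+1}*, 0)` is the step `λ_{j+1}*`.
    letI σinv : ℕ → ((V × ℝ) →ₗ[ℝ] (V × ℝ)) := fun j =>
      (translLin (lam j)).comp (affExt (((w₀ * wpar j)⁻¹ : V ≃ₗ[ℝ] V) : V →ₗ[ℝ] V))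
    letI st : ℕ → V × ℝ := fun j => ((-(w₀ (lam j)) : V), (0 : ℝ))
    ∀ j ≤ m,
      (piSeq σinv st j).sum = lamZero ∧
      R.AffIntegral θ (piSeq σinv st j) ∧
      R.AffDominant θ (piSeq σinv st j) := by
  set σinv : ℕ → ((V × ℝ) →ₗ[ℝ] (V × ℝ)) := fun j =>
    (translLin (lam j)).comp (affExt (((w₀ * wpar j)⁻¹ : V ≃ₗ[ℝ] V) : V →ₗ[ℝ] V))
  set st : ℕ → V × ℝ := fun j => ((-(w₀ (lam j)) : V), (0 : ℝ)) with hst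
  intro j
  have hσ : ∀ j v, σinv j v = ((w₀ * wpar j)⁻¹ v.1 + v.2 • lam j, v.2) := fun j v => rfl
  have hsum : ∀ j < m, σinv j (lamZero + st j) = lamZero := by
    intro j hj
    have h : (wpar j).symm (lam j) = lam j :=
      (wpar j).symm_apply_eq.mpr (hwpar j hj).2.1.symm
    rw [hσ]
    simp [lamZero, hst, h]
  induction j with
  | zero =>
    intro _
    refine ⟨by simp [piSeq, lamZero], ?_, ?_⟩
    · intro v hv
      rw [RootSystemBase.affIntegral_iff hθ]
      obtain rfl : v = (0, 1) := by simpa [piSeq] using hv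
      exact ⟨fun i => ⟨0, by simp [pairc_eq]⟩, 1, by simp⟩
    · intro n hn
      simp only [RootOp.hgt]
      rw [RootSystemBase.inChamber_iff]
      obtain rfl | rfl : n = 0 ∨ n = 1 := by
        simp only [piSeq, List.length_singleton] at hn
        omega
      · simp [RootSystemBase.InChamber, pairc_eq]
      · simpa [piSeq, lamZero] using RootSystemBase.inChamber_lamZero (R := R) (θ := θ)
  | succ j ih =>
    intro hj
    obtain ⟨ih1, ih2, ih3⟩ := ih (by omega)
    have hjm : j < m := hj
    have htot : (piSeq σinv st (j + 1)).sum = lamZero := by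
      rw [piSeq, ← map_list_sum, List.sum_append, ih1, List.sum_singleton, hsum j hjm]
    refine ⟨htot, ?_, ?_⟩
    · intro v hv
      rw [RootSystemBase.affIntegral_iff hθ]
      obtain ⟨u, hu, rfl⟩ := List.mem_map.mp hv
      have hwt : R.IsWeight u.1 ∧ ∃ n : ℤ, u.2 = n := by
        rcases List.mem_append.mp hu with hu | hu
        · exact (RootSystemBase.affIntegral_iff hθ).mp (ih2 u hu)
        · obtain rfl := List.mem_singleton.mp hu
          refine ⟨?_, 0, by simp [hst]⟩
          have h := ((hlam j hjm).isWeight.weyl hw₀.1).int_smul (-1)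
          simpa using h
      obtain ⟨hu1, n, hn⟩ := hwt
      rw [hσ]
      refine ⟨(hu1.weyl (inv_mem (mul_mem hw₀.1 (hwpar j hjm).1))).add ?_, n, hn⟩
      rw [hn]
      exact (hlam j hjm).isWeight.int_smul n
    · intro n hn
      simp only [RootOp.hgt]
      rw [RootSystemBase.inChamber_iff]
      by_cases hle : n ≤ (piSeq σinv st j).length
      · rw [piSeq, ← List.map_take, List.take_append_of_le_length hle, ← map_list_sum, hσ]
        exact (RootSystemBase.inChamber_iff.mp (ih3 n hle)).chamberAut hθ hw₀ (hc j hjm)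
          (hmin j hjm) (hlam j hjm) (hwpar j hjm)
      · rw [List.take_of_length_le, htot]
        · exact RootSystemBase.inChamber_lamZero
        · simp only [piSeq, List.length_map, List.length_append, List.length_singleton]
          omega

end Litt
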